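/- Let H be a minimal counterexample to the main theorem: a plane graph with Δ(H)=6, containing no subgraph isomorphic to a diamond or a house, in which every 6-vertex either is not incident with two 4-cycles sharing an edge or is not incident with three cycles of sizes p,q,ℓ for any {p,q,ℓ} ∈ {{3,4,4},{3,3,4}}, that is not totally 7-colorable, and that minimizes |V(H)|+|E(H)| among all such graphs. Then H contains no vertex v of degree 6 with two distinct neighbors x1, x2 of degree exactly 2 and a neighbor y of degree exactly 3 (all distinct) such that: the neighbor u1 of x1 other than v and the neighbor u2 of x2 other than v are adjacent in H, and u2 is also adjacent to y. -/

import Mathlib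

open SimpleGraph

/-- The degree of a vertex, as `Nat.card` of its neighbor set. -/
noncomputable def vdeg {V : Type*} (G : SimpleGraph V) (v : V) : ℕ :=
  Nat.card (G.neighborSet v)

/-- `G` has maximum degree exactly `k`. -/
def MaxDegreeEq {V : Type*} (G : SimpleGraph V) (k : ℕ) : Prop :=
  (∀ v, vdeg G v ≤ k) ∧ ∃ v, vdeg G v = k

/-- `G` admits a total `k`-coloring: a coloring of vertices and edges with `k` colors such
that adjacent vertices get distinct colors, edges sharing an endpoint get distinct colors,
and each edge gets a color distinct from those of its endpoints. -/
def TotallyColorable {V : Type*} (G : SimpleGraph V) (k : ℕ) : Prop :=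
  ∃ (cv : V → Fin k) (ce : Sym2 V → Fin k),
    (∀ ⦃u v⦄, G.Adj u v → cv u ≠ cv v) ∧
    (∀ e₁ ∈ G.edgeSet, ∀ e₂ ∈ G.edgeSet, e₁ ≠ e₂ → (∃ x, x ∈ e₁ ∧ x ∈ e₂) →
      ce e₁ ≠ ce e₂) ∧
    (∀ ⦃u v⦄, G.Adj u v → ce s(u, v) ≠ cv u)

/-- The diamond: `K₄` minus one edge. -/
def diamondGraph : SimpleGraph (Fin 4) :=
  SimpleGraph.fromEdgeSet {s(0, 1), s(0, 2), s(0, 3), s(1, 2), s(1, 3)}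

/-- The house: a `4`-cycle `1 2 3 4` and a triangle `0 1 4` sharing exactly the edge `{1,4}`
(equivalently, a `5`-cycle plus one chord). -/
def houseGraph : SimpleGraph (Fin 5) :=
  SimpleGraph.fromEdgeSet {s(0, 1), s(1, 2), s(2, 3), s(3, 4), s(4, 0), s(1, 4)}

/-- `G` contains a (not necessarily induced) subgraph isomorphic to `H`. -/
def ContainsCopy {α β : Type*} (H : SimpleGraph α) (G : SimpleGraph β) : Prop :=
  ∃ f : α → β, Function.Injective f ∧ ∀ ⦃u v⦄, H.Adj u v → G.Adj (f u) (f v)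

/-- `v` is incident with two distinct `4`-cycles of `G` that share an edge. -/
def TwoAdjacentFourCyclesAt {V : Type*} (G : SimpleGraph V) (v : V) : Prop :=
  ∃ (c₁ c₂ : G.Walk v v), c₁.IsCycle ∧ c₂.IsCycle ∧ c₁.length = 4 ∧ c₂.length = 4 ∧
    {e | e ∈ c₁.edges} ≠ {e | e ∈ c₂.edges} ∧ ∃ e, e ∈ c₁.edges ∧ e ∈ c₂.edges

/-- `v` is incident with three pairwise distinct cycles of `G`, of lengths `p`, `q`, `ℓ`. -/
def ThreeCyclesAt {V : Type*} (G : SimpleGraph V) (v : V) (p q ℓ : ℕ) : Prop :=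
  ∃ (c₁ c₂ c₃ : G.Walk v v), c₁.IsCycle ∧ c₂.IsCycle ∧ c₃.IsCycle ∧
    c₁.length = p ∧ c₂.length = q ∧ c₃.length = ℓ ∧
    {e | e ∈ c₁.edges} ≠ {e | e ∈ c₂.edges} ∧
    {e | e ∈ c₁.edges} ≠ {e | e ∈ c₃.edges} ∧
    {e | e ∈ c₂.edges} ≠ {e | e ∈ c₃.edges}

/-- Every `6`-vertex of `G` is not incident with two `4`-cycles sharing an edge, or is not
incident with three cycles of sizes `p, q, ℓ` for any `{p,q,ℓ} ∈ {{3,4,4},{3,3,4}}`. -/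
def Good6Vertices {V : Type*} (G : SimpleGraph V) : Prop :=
  ∀ v, vdeg G v = 6 →
    (¬ TwoAdjacentFourCyclesAt G v) ∨
    (∀ p q ℓ : ℕ, (({p, q, ℓ} : Multiset ℕ) = {3, 4, 4} ∨ ({p, q, ℓ} : Multiset ℕ) = {3, 3, 4}) →
      ¬ ThreeCyclesAt G v p q ℓ)

/-- Reversal of darts, as a permutation. -/
def dartRev {V : Type*} (G : SimpleGraph V) : Equiv.Perm G.Dart :=
  Function.Involutive.toPerm SimpleGraph.Dart.symm SimpleGraph.Dart.symm_involutive

/-- A rotation system (combinatorial embedding) of `G`: a permutation of the darts whose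
orbits are exactly the sets of darts emanating from each single vertex. -/
structure RotationSystem {V : Type*} (G : SimpleGraph V) where
  σ : Equiv.Perm G.Dart
  tail_fixed : ∀ d : G.Dart, (σ d).fst = d.fst
  vertex_cycles : ∀ d d' : G.Dart, d.fst = d'.fst → σ.SameCycle d d'

namespace RotationSystem

variable {V : Type*} {G : SimpleGraph V}

/-- The face-tracing permutation of a rotation system. -/
def φ (R : RotationSystem G) : Equiv.Perm G.Dart :=
  R.σ * dartRev G

/-- Two darts lie on the same face iff they are in the same orbit of the face-tracing
permutation. -/
def faceSetoid (R : RotationSystem G) : Setoid G.Dart where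
  r := R.φ.SameCycle
  iseqv := ⟨fun d => Equiv.Perm.SameCycle.refl _ d, Equiv.Perm.SameCycle.symm,
    Equiv.Perm.SameCycle.trans⟩

/-- The faces of the embedding: orbits of the face-tracing permutation. -/
def Faces (R : RotationSystem G) : Type _ :=
  Quotient R.faceSetoid

/-- The number of faces of the embedding. -/
noncomputable def numFaces (R : RotationSystem G) : ℕ :=
  Nat.card R.Faces

/-- The darts of the face containing the dart `d`. -/
def faceDarts (R : RotationSystem G) (d : G.Dart) : Set G.Dart :=
  {d' | R.φ.SameCycle d d'}

/-- The degree (length of the boundary walk, cut edges counted twice) of the face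
containing the dart `d`. -/
noncomputable def faceDeg (R : RotationSystem G) (d : G.Dart) : ℕ :=
  (R.faceDarts d).ncard

/-- The vertex `v` is incident with the face containing the dart `d`. -/
def FaceIncident (R : RotationSystem G) (v : V) (d : G.Dart) : Prop :=
  ∃ d' ∈ R.faceDarts d, d'.fst = v

/-- A rotation system is a plane embedding when it satisfies Euler's formula
`|V| - |E| + |F| = 2` on each connected component, i.e. `|V| + |F| = |E| + 2c`. -/
def IsPlanarEmbedding [Fintype V] (R : RotationSystem G) : Prop :=
  Fintype.card V + R.numFaces = Nat.card G.edgeSet + 2 * Nat.card G.ConnectedComponent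

end RotationSystem

/-- A graph is planar if it admits a plane embedding. -/
def IsPlanar {V : Type*} [Fintype V] (G : SimpleGraph V) : Prop :=
  ∃ R : RotationSystem G, R.IsPlanarEmbedding

/-- Conditions (1), (2), (3) on graphs in Theorem 1: planar of maximum degree 6, with no
diamond and no house subgraph, and every 6-vertex not incident with two adjacent 4-cycles
or not incident with three cycles of sizes in `{{3,4,4},{3,3,4}}`. -/
def GoodGraph {V : Type*} [Fintype V] (G : SimpleGraph V) : Prop :=
  IsPlanar G ∧ MaxDegreeEq G 6 ∧ ¬ ContainsCopy diamondGraph G ∧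
    ¬ ContainsCopy houseGraph G ∧ Good6Vertices G

/-- `H` is a minimal counterexample to the main theorem: it satisfies conditions (1)–(3),
is not totally 7-colorable, and minimizes `|V| + |E|` among all such graphs. -/
def MinimalCounterexample {V : Type*} [Fintype V] (H : SimpleGraph V) : Prop :=
  GoodGraph H ∧ ¬ TotallyColorable H 7 ∧
    ∀ (n : ℕ) (G : SimpleGraph (Fin n)), GoodGraph G → ¬ TotallyColorable G 7 →
      Fintype.card V + Nat.card H.edgeSet ≤ n + Nat.card G.edgeSet


namespace Cfg3

lemma card_le_succ {A B : Type*} [Finite A] [Finite B] (f : A → B) (p q : A)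
    (h : ∀ a b, f a = f b → a = b ∨ ((a = p ∨ a = q) ∧ (b = p ∨ b = q))) :
    Nat.card A ≤ Nat.card B + 1 := by
  classical
  have hinj : Function.Injective (fun a => if a = p then none else some (f a) : A → Option B) := by
    intro a b hab
    by_cases ha : a = p <;> by_cases hb : b = p <;> simp [ha, hb] at hab
    · rw [ha, hb]
    · rcases h a b hab with h | ⟨h1, h2⟩
      · exact h
      · rw [h1.resolve_left ha, h2.resolve_left hb]
  have := Nat.card_le_card_of_injective _ hinj
  rwa [Finite.card_option] at this

noncomputable def nc {D : Type*} (π : Equiv.Perm D) : ℕ :=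
  Nat.card (Quotient (Equiv.Perm.SameCycle.setoid π))

lemma sameCycle_le {D : Type*} (π : Equiv.Perm D) (r : D → D → Prop) (hr : Equivalence r)
    (h : ∀ z, r z (π z)) {z w : D} (hzw : π.SameCycle z w) : r z w := by
  have hn : ∀ (n : ℕ) (z : D), r z ((π ^ n) z) := by
    intro n
    induction n with
    | zero => intro z; exact hr.refl z
    | succ k ih =>
      intro z
      rw [pow_succ', Equiv.Perm.mul_apply]
      exact hr.trans (ih z) (h _)
  obtain ⟨i, hi⟩ := hzw
  obtain ⟨n, rfl | rfl⟩ := i.eq_nat_or_neg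
  · rw [zpow_natCast] at hi; rw [← hi]; exact hn n z
  · have : z = (π ^ n) w := by rw [← hi]; simp
    rw [this]; exact hr.symm (hn n w)

lemma sameCycle_equiv {D : Type*} (π : Equiv.Perm D) : Equivalence π.SameCycle :=
  ⟨fun d => Equiv.Perm.SameCycle.refl _ d, Equiv.Perm.SameCycle.symm, Equiv.Perm.SameCycle.trans⟩

lemma sameCycle_step {D : Type*} (π : Equiv.Perm D) (z : D) : π.SameCycle z (π z) := ⟨1, by simp⟩

section swap
variable {D : Type*} [DecidableEq D] (π : Equiv.Perm D) (x y : D)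

lemma coarser_of_same (h : (π * Equiv.swap x y).SameCycle x y) {z w : D}
    (hzw : π.SameCycle z w) : (π * Equiv.swap x y).SameCycle z w := by
  refine sameCycle_le π _ (sameCycle_equiv _) ?_ hzw
  intro z
  by_cases hx : z = x
  · subst hx
    have := sameCycle_step (π * Equiv.swap z y) y
    simp at this
    exact h.trans (by simpa using this)
  by_cases hy : z = y
  · subst hy
    have := sameCycle_step (π * Equiv.swap x z) x
    simp at this
    exact h.symm.trans (by simpa using this)
  have := sameCycle_step (π * Equiv.swap x y) z
  rwa [Equiv.Perm.mul_apply, Equiv.swap_apply_of_ne_of_ne hx hy] at this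

lemma same_of_not_same [Finite D] (h : ¬ π.SameCycle x y) :
    (π * Equiv.swap x y).SameCycle x y := by
  set π' := π * Equiv.swap x y with hπ'
  have key : ∀ n : ℕ, π'.SameCycle y ((π ^ (n+1)) x) ∨ π'.SameCycle y x := by
    intro n
    induction n with
    | zero =>
      left
      have := sameCycle_step π' y
      simpa [hπ'] using this
    | succ k ih =>
      rcases ih with ih | ih
      · by_cases hx : (π ^ (k+1)) x = x
        · right; rwa [hx] at ih
        · have hy : (π ^ (k+1)) x ≠ y := fun e => h ⟨(k+1 : ℕ), by rw [zpow_natCast]; exact e⟩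
          left
          have := sameCycle_step π' ((π ^ (k+1)) x)
          rw [hπ', Equiv.Perm.mul_apply, Equiv.swap_apply_of_ne_of_ne hx hy, ← hπ'] at this
          rw [pow_succ', Equiv.Perm.mul_apply]
          exact ih.trans this
      · right; exact ih
  have hpos : 0 < orderOf π := orderOf_pos π
  have := key (orderOf π - 1)
  rw [Nat.sub_add_cancel hpos, pow_orderOf_eq_one] at this
  simp at this
  exact this.symm

lemma nc_lt [Finite D] (h : ¬ π.SameCycle x y) : nc (π * Equiv.swap x y) + 1 ≤ nc π := by
  classical
  have := Fintype.ofFinite D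
  have hs := same_of_not_same π x y h
  let f : Quotient (Equiv.Perm.SameCycle.setoid π) →
      Quotient (Equiv.Perm.SameCycle.setoid (π * Equiv.swap x y)) :=
    Quotient.map' id (fun a b hab => coarser_of_same π x y hs hab)
  have hsurj : Function.Surjective f := by
    intro q
    induction q using Quotient.inductionOn with
    | h a => exact ⟨Quotient.mk _ a, rfl⟩
  have hle := Nat.card_le_card_of_surjective f hsurj
  rcases hle.lt_or_eq with hlt | heq
  · exact hlt
  · exfalso
    have hb := (Nat.bijective_iff_surjective_and_card f).2 ⟨hsurj, heq.symm⟩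
    have : (Quotient.mk (Equiv.Perm.SameCycle.setoid π) x) = Quotient.mk _ y := by
      apply hb.1
      exact Quotient.sound hs
    exact h (Quotient.exact this)

lemma swap_swap_mul : (π * Equiv.swap x y) * Equiv.swap x y = π := by
  rw [mul_assoc, Equiv.swap_mul_self, mul_one]

lemma nc_le [Finite D] (h : π.SameCycle x y) : nc (π * Equiv.swap x y) ≤ nc π + 1 := by
  classical
  have := Fintype.ofFinite D
  set π' := π * Equiv.swap x y with hπ'
  have hπ : π' * Equiv.swap x y = π := swap_swap_mul π x y
  have h' : (π' * Equiv.swap x y).SameCycle x y := by rwa [hπ]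
  let f : Quotient (Equiv.Perm.SameCycle.setoid π') →
      Quotient (Equiv.Perm.SameCycle.setoid π) :=
    Quotient.map' id (fun a b hab => by
      have := coarser_of_same π' x y h' hab
      rw [hπ] at this; exact this)
  refine card_le_succ f (Quotient.mk _ x) (Quotient.mk _ y) ?_
  intro a b
  induction a using Quotient.inductionOn with
  | h z =>
  induction b using Quotient.inductionOn with
  | h w =>
  intro hzw
  have hzw : π.SameCycle z w := Quotient.exact hzw
  have hE := sameCycle_equiv π'
  have : π'.SameCycle z w ∨ ((π'.SameCycle z x ∨ π'.SameCycle z y) ∧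
      (π'.SameCycle w x ∨ π'.SameCycle w y)) := by
    refine sameCycle_le π (fun z w => π'.SameCycle z w ∨ ((π'.SameCycle z x ∨ π'.SameCycle z y) ∧
      (π'.SameCycle w x ∨ π'.SameCycle w y))) ⟨?_, ?_, ?_⟩ ?_ hzw
    · intro a; left; exact hE.refl a
    · rintro a b (h | h)
      · left; exact hE.symm h
      · right; exact ⟨h.2, h.1⟩
    · rintro a b c (h | h) (h' | h')
      · left; exact hE.trans h h'
      · right; exact ⟨h'.1.imp (hE.trans h) (hE.trans h), h'.2⟩
      · right; exact ⟨h.1, h.2.imp (hE.trans (hE.symm h')) (hE.trans (hE.symm h'))⟩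
      · right; exact ⟨h.1, h'.2⟩
    · intro a
      by_cases hx : a = x
      · right
        refine ⟨Or.inl (hx ▸ hE.refl _), Or.inr ?_⟩
        have := sameCycle_step π' y
        rw [hx]; simpa [hπ'] using hE.symm this
      by_cases hy : a = y
      · right
        refine ⟨Or.inr (hy ▸ hE.refl _), Or.inl ?_⟩
        have := sameCycle_step π' x
        rw [hy]; simpa [hπ'] using hE.symm this
      left
      have := sameCycle_step π' a
      rwa [hπ', Equiv.Perm.mul_apply, Equiv.swap_apply_of_ne_of_ne hx hy, ← hπ'] at this
  rcases this with h | ⟨h1, h2⟩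
  · left; exact Quotient.sound h
  · right
    exact ⟨h1.imp (fun h => Quotient.sound h) (fun h => Quotient.sound h),
      h2.imp (fun h => Quotient.sound h) (fun h => Quotient.sound h)⟩

end swap

/-- First-return maps have the same number of cycles. -/
lemma firstReturn_same {D D' : Type*} (π : Equiv.Perm D) (π' : Equiv.Perm D')
    (ι : D' → D) (hι : Function.Injective ι)
    (hX : ∀ z, z ∉ Set.range ι → π z ∈ Set.range ι)
    (h1 : ∀ x, π (ι x) ∈ Set.range ι → ι (π' x) = π (ι x))
    (h2 : ∀ x, π (ι x) ∉ Set.range ι → ι (π' x) = π (π (ι x))) (x y : D') :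
    π.SameCycle (ι x) (ι y) ↔ π'.SameCycle x y := by
  classical
  constructor
  · intro h
    have hr : ∀ z, ∃ w, (z ∈ Set.range ι → ι w = z) ∧ (z ∉ Set.range ι → ι w = π z) := by
      intro z
      by_cases hz : z ∈ Set.range ι
      · obtain ⟨w, hw⟩ := hz
        exact ⟨w, fun _ => hw, fun h => absurd ⟨w, hw⟩ h⟩
      · obtain ⟨w, hw⟩ := hX z hz
        exact ⟨w, fun h => absurd h hz, fun _ => hw⟩
    choose r hr1 hr2 using hr
    have hrι : ∀ x, r (ι x) = x := fun x => hι (hr1 _ ⟨x, rfl⟩)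
    have hE := sameCycle_equiv π'
    have := sameCycle_le π (fun z w => π'.SameCycle (r z) (r w))
      ⟨fun a => hE.refl _, fun h => hE.symm h, fun h h' => hE.trans h h'⟩ ?_ h
    · simpa only [hrι] using this
    · intro z
      by_cases hz : z ∈ Set.range ι
      · obtain ⟨x, rfl⟩ := hz
        have : r (π (ι x)) = π' x := by
          apply hι
          by_cases hz : π (ι x) ∈ Set.range ι
          · rw [hr1 _ hz, h1 _ hz]
          · rw [hr2 _ hz, h2 _ hz]
        show π'.SameCycle _ _
        rw [this, hrι]
        exact sameCycle_step _ _
      · have : r (π z) = r z := by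
          apply hι
          rw [hr2 _ hz, hr1 _ (hX z hz)]
        show π'.SameCycle _ _
        rw [this]
  · intro h
    have hE := sameCycle_equiv π
    refine sameCycle_le π' (fun a b => π.SameCycle (ι a) (ι b))
      ⟨fun a => hE.refl _, fun h => hE.symm h, fun h h' => hE.trans h h'⟩ ?_ h
    intro z
    show π.SameCycle _ _
    by_cases hz : π (ι z) ∈ Set.range ι
    · rw [h1 _ hz]; exact sameCycle_step _ _
    · rw [h2 _ hz]; exact (sameCycle_step _ _).trans (sameCycle_step _ _)

lemma firstReturn_nc {D D' : Type*} (π : Equiv.Perm D) (π' : Equiv.Perm D')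
    (ι : D' → D) (hι : Function.Injective ι)
    (hX : ∀ z, z ∉ Set.range ι → π z ∈ Set.range ι)
    (h1 : ∀ x, π (ι x) ∈ Set.range ι → ι (π' x) = π (ι x))
    (h2 : ∀ x, π (ι x) ∉ Set.range ι → ι (π' x) = π (π (ι x))) :
    nc π' = nc π := by
  have key := firstReturn_same π π' ι hι hX h1 h2
  let f : Quotient (Equiv.Perm.SameCycle.setoid π') →
      Quotient (Equiv.Perm.SameCycle.setoid π) :=
    Quotient.map' ι (fun a b hab => (key a b).2 hab)
  refine Nat.card_congr (Equiv.ofBijective f ⟨?_, ?_⟩)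
  · intro a b
    induction a using Quotient.inductionOn with
    | h z =>
    induction b using Quotient.inductionOn with
    | h w =>
    intro hzw
    exact Quotient.sound ((key z w).1 (Quotient.exact hzw))
  · intro q
    induction q using Quotient.inductionOn with
    | h a =>
    by_cases ha : a ∈ Set.range ι
    · obtain ⟨x, rfl⟩ := ha
      exact ⟨Quotient.mk _ x, rfl⟩
    · obtain ⟨x, hx⟩ := hX a ha
      refine ⟨Quotient.mk _ x, Quotient.sound ?_⟩
      show π.SameCycle (ι x) a
      rw [hx]; exact (sameCycle_step _ _).symm

end Cfg3

namespace Cfg3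

open Classical in
/-- Reversal of the darts in the spanning subgraph `K`, others are fixed. -/
noncomputable def al {V : Type*} {H : SimpleGraph V} (K : SimpleGraph V) : Equiv.Perm H.Dart :=
  Function.Involutive.toPerm (fun d => if K.Adj d.fst d.snd then d.symm else d) (by
    intro d
    by_cases h : K.Adj d.fst d.snd
    · simp [h, h.symm]
    · simp [h])

lemma al_pos {V : Type*} {H : SimpleGraph V} (K : SimpleGraph V) (d : H.Dart)
    (h : K.Adj d.fst d.snd) : al K d = d.symm := if_pos h

lemma al_neg {V : Type*} {H : SimpleGraph V} (K : SimpleGraph V) (d : H.Dart)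
    (h : ¬ K.Adj d.fst d.snd) : al K d = d := if_neg h

lemma al_self {V : Type*} {H : SimpleGraph V} : al H = dartRev H := by
  ext1 d
  rw [al_pos _ _ d.adj]; rfl

open Classical in
lemma al_del {V : Type*} {H : SimpleGraph V} (K : SimpleGraph V) (d : H.Dart)
    (h : K.Adj d.fst d.snd) :
    (al K : Equiv.Perm H.Dart) = al (K.deleteEdges {s(d.fst, d.snd)}) * Equiv.swap d d.symm := by
  have hd : ¬ (K.deleteEdges {s(d.fst, d.snd)}).Adj d.fst d.snd := by simp
  have hd' : ¬ (K.deleteEdges {s(d.fst, d.snd)}).Adj d.symm.fst d.symm.snd := by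
    simp [Sym2.eq_swap]
  ext1 x
  rw [Equiv.Perm.mul_apply]
  by_cases h1 : x = d
  · subst h1
    rw [Equiv.swap_apply_left, al_neg _ _ hd', al_pos _ _ h]
  by_cases h2 : x = d.symm
  · subst h2
    rw [Equiv.swap_apply_right, al_neg _ _ hd, al_pos _ _ h.symm, SimpleGraph.Dart.symm_symm]
  rw [Equiv.swap_apply_of_ne_of_ne h1 h2]
  by_cases hx : K.Adj x.fst x.snd
  · rw [al_pos _ _ hx, al_pos]
    rw [SimpleGraph.deleteEdges_adj]
    refine ⟨hx, ?_⟩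
    intro hh
    have : x.edge = d.edge := hh
    rw [SimpleGraph.dart_edge_eq_iff] at this
    tauto
  · rw [al_neg _ _ hx, al_neg]
    rw [SimpleGraph.deleteEdges_adj]
    tauto

noncomputable def cc {V : Type*} (K : SimpleGraph V) : ℕ := Nat.card K.ConnectedComponent

lemma reach_del {V : Type*} (K : SimpleGraph V) (a b : V) {z w : V} (h : K.Reachable z w) :
    (K.deleteEdges {s(a, b)}).Reachable z w ∨
      (((K.deleteEdges {s(a, b)}).Reachable z a ∨ (K.deleteEdges {s(a, b)}).Reachable z b) ∧
      ((K.deleteEdges {s(a, b)}).Reachable w a ∨ (K.deleteEdges {s(a, b)}).Reachable w b)) := by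
  set K' := K.deleteEdges {s(a, b)} with hK'
  obtain ⟨p⟩ := h
  induction p with
  | nil => left; exact SimpleGraph.Reachable.refl _
  | @cons u v w huv p ih =>
    by_cases he : s(u, v) = s(a, b)
    · right
      have hu : K'.Reachable u a ∨ K'.Reachable u b := by
        rcases Sym2.eq_iff.1 he with ⟨rfl, rfl⟩ | ⟨rfl, rfl⟩
        · left; rfl
        · right; rfl
      have hv : K'.Reachable v a ∨ K'.Reachable v b := by
        rcases Sym2.eq_iff.1 he with ⟨rfl, rfl⟩ | ⟨rfl, rfl⟩
        · right; rfl
        · left; rfl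
      refine ⟨hu, ?_⟩
      rcases ih with ih | ih
      · exact hv.imp ih.symm.trans ih.symm.trans
      · exact ih.2
    · have hr : K'.Reachable u v := by
        apply SimpleGraph.Adj.reachable
        rw [hK', SimpleGraph.deleteEdges_adj]
        exact ⟨huv, he⟩
      rcases ih with ih | ih
      · left; exact hr.trans ih
      · right; exact ⟨ih.1.imp hr.trans hr.trans, ih.2⟩

lemma cc_del {V : Type*} [Finite V] (K : SimpleGraph V) (a b : V) :
    cc (K.deleteEdges {s(a, b)}) ≤ cc K + 1 := by
  set K' := K.deleteEdges {s(a, b)} with hK'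
  have hle : K' ≤ K := SimpleGraph.deleteEdges_le _
  refine card_le_succ (SimpleGraph.ConnectedComponent.map (SimpleGraph.Hom.ofLE hle))
    (K'.connectedComponentMk a) (K'.connectedComponentMk b) ?_
  intro p q
  induction p using SimpleGraph.ConnectedComponent.ind with
  | h z =>
  induction q using SimpleGraph.ConnectedComponent.ind with
  | h w =>
  intro h
  have h : K.Reachable z w := SimpleGraph.ConnectedComponent.exact h
  simp only [SimpleGraph.ConnectedComponent.eq]
  exact reach_del K a b h

lemma cc_del' {V : Type*} [Finite V] (K : SimpleGraph V) (a b : V)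
    (hab : (K.deleteEdges {s(a, b)}).Reachable a b) :
    cc (K.deleteEdges {s(a, b)}) ≤ cc K := by
  set K' := K.deleteEdges {s(a, b)} with hK'
  have hle : K' ≤ K := SimpleGraph.deleteEdges_le _
  refine Nat.card_le_card_of_injective
    (SimpleGraph.ConnectedComponent.map (SimpleGraph.Hom.ofLE hle)) ?_
  intro p q
  induction p using SimpleGraph.ConnectedComponent.ind with
  | h z =>
  induction q using SimpleGraph.ConnectedComponent.ind with
  | h w =>
  intro h
  have h : K.Reachable z w := SimpleGraph.ConnectedComponent.exact h
  simp only [SimpleGraph.ConnectedComponent.eq]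
  rcases reach_del K a b h with h | ⟨h1 | h1, h2 | h2⟩
  · exact h
  · exact h1.trans h2.symm
  · exact h1.trans (hab.trans h2.symm)
  · exact h1.trans (hab.symm.trans h2.symm)
  · exact h1.trans h2.symm

lemma card_edges_del {V : Type*} [Finite V] (K : SimpleGraph V) (a b : V) (h : K.Adj a b) :
    Nat.card (K.deleteEdges {s(a, b)}).edgeSet + 1 = Nat.card K.edgeSet := by
  rw [SimpleGraph.edgeSet_deleteEdges]
  simp only [Nat.card_coe_set_eq]
  exact Set.ncard_sdiff_singleton_add_one (by simpa using h) (Set.toFinite _)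

lemma same_reach {V : Type*} {H : SimpleGraph V} (R : RotationSystem H) (K : SimpleGraph V)
    {x y : H.Dart} (h : (R.σ * al K).SameCycle x y) : K.Reachable x.fst y.fst := by
  refine sameCycle_le _ (fun x y : H.Dart => K.Reachable x.fst y.fst)
    ⟨fun _ => SimpleGraph.Reachable.refl _, fun h => h.symm, fun h h' => h.trans h'⟩ ?_ h
  intro z
  show K.Reachable _ _
  rw [Equiv.Perm.mul_apply, R.tail_fixed]
  by_cases hz : K.Adj z.fst z.snd
  · rw [al_pos _ _ hz]; exact hz.reachable
  · rw [al_neg _ _ hz]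

lemma euler_step {V : Type*} [Finite V] {H : SimpleGraph V} (R : RotationSystem H)
    (K : SimpleGraph V) (hK : K ≤ H) (a b : V) (hab : K.Adj a b) :
    Nat.card (K.deleteEdges {s(a, b)}).edgeSet + 2 * cc (K.deleteEdges {s(a, b)}) +
        nc (R.σ * al K) ≤
      Nat.card K.edgeSet + 2 * cc K + nc (R.σ * al (K.deleteEdges {s(a, b)})) := by
  classical
  have : Finite H.Dart := by
    have := Fintype.ofFinite V
    infer_instance
  let d : H.Dart := ⟨(a, b), hK hab⟩
  have hE := card_edges_del K a b hab
  have hal : R.σ * al K = (R.σ * al (K.deleteEdges {s(a, b)})) * Equiv.swap d d.symm := by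
    rw [mul_assoc]; congr 1
    exact al_del K d hab
  rw [hal]
  by_cases hs : (R.σ * al (K.deleteEdges {s(a, b)})).SameCycle d d.symm
  · have h1 := nc_le _ _ _ hs
    have h2 := cc_del' K a b (same_reach R _ hs)
    omega
  · have h1 := nc_lt _ _ _ hs
    have h2 := cc_del K a b
    omega

lemma euler_ineq {V : Type*} [Finite V] {H : SimpleGraph V} (R : RotationSystem H)
    (K : SimpleGraph V) (hK : K ≤ H) :
    Nat.card V + nc (R.σ * al K) ≤ Nat.card K.edgeSet + 2 * cc K := by
  classical
  induction hn : Nat.card K.edgeSet generalizing K with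
  | zero =>
    have hK0 : ∀ a b, ¬ K.Adj a b := by
      intro a b hab
      have := card_edges_del K a b hab
      omega
    have h1 : cc K = Nat.card V := by
      refine (Nat.card_congr (Equiv.ofBijective K.connectedComponentMk ⟨?_, ?_⟩)).symm
      · intro a b hab
        obtain ⟨p⟩ := SimpleGraph.ConnectedComponent.exact hab
        cases p with
        | nil => rfl
        | cons h _ => exact absurd h (hK0 _ _)
      · intro q
        induction q using SimpleGraph.ConnectedComponent.ind with
        | h z => exact ⟨z, rfl⟩
    have h2 : nc (R.σ * al K) ≤ Nat.card V := by
      have : R.σ * al K = R.σ := by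
        ext1 x
        rw [Equiv.Perm.mul_apply, al_neg _ _ (hK0 _ _)]
      rw [this]
      let f : Quotient (Equiv.Perm.SameCycle.setoid R.σ) → V :=
        Quotient.lift (fun d => d.fst) (by
          intro a b hab
          exact sameCycle_le R.σ (fun x y : H.Dart => x.fst = y.fst)
            ⟨fun _ => rfl, fun h => h.symm, fun h h' => h.trans h'⟩
            (fun z => (R.tail_fixed z).symm) hab)
      refine Nat.card_le_card_of_injective f ?_
      intro a b
      induction a using Quotient.inductionOn with
      | h z =>
      induction b using Quotient.inductionOn with
      | h w =>
      intro hzw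
      exact Quotient.sound (R.vertex_cycles z w hzw)
    omega
  | succ n ih =>
    have : ∃ a b, K.Adj a b := by
      by_contra hcon
      push Not at hcon
      have : K = ⊥ := by ext a b; simp [hcon a b]
      rw [this] at hn
      simp at hn
    obtain ⟨a, b, hab⟩ := this
    have h1 := euler_step R K hK a b hab
    have hE := card_edges_del K a b hab
    have h2 := ih (K.deleteEdges {s(a, b)}) ((SimpleGraph.deleteEdges_le _).trans hK) (by omega)
    omega

lemma euler_del {V : Type*} [Fintype V] {H : SimpleGraph V} (R : RotationSystem H)
    (hR : R.IsPlanarEmbedding) (a b : V) (hab : H.Adj a b) :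
    Nat.card V + nc (R.σ * al (H.deleteEdges {s(a, b)})) =
      Nat.card (H.deleteEdges {s(a, b)}).edgeSet + 2 * cc (H.deleteEdges {s(a, b)}) := by
  have h1 := euler_ineq R (H.deleteEdges {s(a, b)}) (SimpleGraph.deleteEdges_le _)
  have h2 := euler_step R H le_rfl a b hab
  have h3 : Nat.card V + nc (R.σ * al H) = Nat.card H.edgeSet + 2 * cc H := by
    rw [al_self, Nat.card_eq_fintype_card]; exact hR
  omega

/-- Deleting an edge whose ends have other neighbors preserves planarity. -/
lemma planar_del {V W : Type*} [Fintype V] [Fintype W] {H : SimpleGraph V}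
    (hH : IsPlanar H) (a b a' b' : V) (hab : H.Adj a b) (haa : H.Adj a a') (ha' : a' ≠ b)
    (hbb : H.Adj b b') (hb' : b' ≠ a)
    (G : SimpleGraph W) (e : G ≃g H.deleteEdges {s(a, b)}) : IsPlanar G := by
  classical
  obtain ⟨R, hR⟩ := hH
  set H' := H.deleteEdges {s(a, b)} with hH'
  have hle : H' ≤ H := SimpleGraph.deleteEdges_le _
  let d : H.Dart := ⟨(a, b), hab⟩
  let ι : G.Dart → H.Dart := fun x => ⟨(e x.fst, e x.snd), hle (e.map_adj_iff.2 x.adj)⟩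
  have hιfst : ∀ x, (ι x).fst = e x.fst := fun _ => rfl
  have hιsymm : ∀ x, ι x.symm = (ι x).symm := fun _ => rfl
  have hι : Function.Injective ι := by
    intro x y hxy
    have h1 : e x.fst = e y.fst := congrArg (fun z : H.Dart => z.fst) hxy
    have h2 : e x.snd = e y.snd := congrArg (fun z : H.Dart => z.snd) hxy
    exact SimpleGraph.Dart.ext _ _ (Prod.ext (e.injective h1) (e.injective h2))
  have hrange' : ∀ z : H.Dart, z ∈ Set.range ι ↔ H'.Adj z.fst z.snd := by
    intro z
    constructor
    · rintro ⟨x, rfl⟩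
      exact e.map_adj_iff.2 x.adj
    · intro hz
      refine ⟨⟨(e.symm z.fst, e.symm z.snd), e.symm.map_adj_iff.2 hz⟩, ?_⟩
      apply SimpleGraph.Dart.ext
      simp [ι]
  have hrange : ∀ z : H.Dart, z ∉ Set.range ι ↔ z = d ∨ z = d.symm := by
    intro z
    rw [hrange', hH', SimpleGraph.deleteEdges_adj]
    have : z.edge = d.edge ↔ z = d ∨ z = d.symm := SimpleGraph.dart_edge_eq_iff _ _
    have h2 : s(z.fst, z.snd) = s(a, b) ↔ z = d ∨ z = d.symm := this
    simp only [z.adj, Set.mem_singleton_iff, h2, true_and, not_not]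
  have hne : ∀ x y : H.Dart, x.fst = y.fst → x ≠ y → R.σ x ≠ x := by
    intro x y hxy hne hfix
    apply hne
    have := sameCycle_le R.σ (fun u w => u = x ↔ w = x)
      ⟨fun _ => Iff.rfl, fun h => h.symm, fun h h' => h.trans h'⟩ (by
        intro z
        constructor
        · rintro rfl; exact hfix
        · intro h; exact R.σ.injective (h.trans hfix.symm)) (R.vertex_cycles x y hxy)
    exact (this.1 rfl).symm
  have hX : ∀ z, z ∉ Set.range ι → R.σ z ∈ Set.range ι := by
    intro z hz
    by_contra hcon
    rw [hrange] at hz hcon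
    have htail := R.tail_fixed z
    have hdn : a ≠ b := hab.ne
    rcases hz with rfl | rfl
    · rcases hcon with h | h
      · refine hne d ⟨(a, a'), haa⟩ rfl ?_ h
        intro hh
        exact ha' (congrArg (fun z : H.Dart => z.snd) hh).symm
      · rw [h] at htail; exact hdn htail.symm
    · rcases hcon with h | h
      · rw [h] at htail; exact hdn htail
      · refine hne d.symm ⟨(b, b'), hbb⟩ rfl ?_ h
        intro hh
        exact hb' (congrArg (fun z : H.Dart => z.snd) hh).symm
  have hex : ∀ x, ∃ y, (R.σ (ι x) ∈ Set.range ι → ι y = R.σ (ι x)) ∧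
      (R.σ (ι x) ∉ Set.range ι → ι y = R.σ (R.σ (ι x))) := by
    intro x
    by_cases hz : R.σ (ι x) ∈ Set.range ι
    · obtain ⟨w, hw⟩ := hz
      exact ⟨w, fun _ => hw, fun h => absurd ⟨w, hw⟩ h⟩
    · obtain ⟨w, hw⟩ := hX _ hz
      exact ⟨w, fun h => absurd h hz, fun _ => hw⟩
  choose s hs1 hs2 using hex
  have hsinj : Function.Injective s := by
    intro x y hxy
    apply hι
    by_cases h1 : R.σ (ι x) ∈ Set.range ι <;> by_cases h2 : R.σ (ι y) ∈ Set.range ι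
    · apply R.σ.injective
      rw [← hs1 x h1, ← hs1 y h2, hxy]
    · exfalso
      apply h2
      have : R.σ (ι x) = R.σ (R.σ (ι y)) := by rw [← hs1 x h1, ← hs2 y h2, hxy]
      exact ⟨x, R.σ.injective this⟩
    · exfalso
      apply h1
      have : R.σ (ι y) = R.σ (R.σ (ι x)) := by rw [← hs1 y h2, ← hs2 x h1, hxy]
      exact ⟨y, R.σ.injective this⟩
    · apply R.σ.injective
      apply R.σ.injective
      rw [← hs2 x h1, ← hs2 y h2, hxy]
  let σ' : Equiv.Perm G.Dart := Equiv.ofBijective s (Finite.injective_iff_bijective.1 hsinj)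
  have hσ' : ∀ x, σ' x = s x := fun _ => rfl
  let R' : RotationSystem G :=
    { σ := σ'
      tail_fixed := by
        intro x
        apply e.injective
        rw [← hιfst, ← hιfst, hσ']
        by_cases h1 : R.σ (ι x) ∈ Set.range ι
        · rw [hs1 x h1, R.tail_fixed]
        · rw [hs2 x h1, R.tail_fixed, R.tail_fixed]
      vertex_cycles := by
        intro x y hxy
        rw [← firstReturn_same R.σ σ' ι hι hX (fun x h => hs1 x h) (fun x h => hs2 x h)]
        apply R.vertex_cycles
        rw [hιfst, hιfst, hxy] }
  refine ⟨R', ?_⟩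
  have hal : ∀ x, al H' (ι x) = ι x.symm := fun x => al_pos _ _ ((hrange' _).1 ⟨x, rfl⟩)
  have hal' : ∀ z, z ∉ Set.range ι → al H' z = z :=
    fun z hz => al_neg _ _ (fun h => hz ((hrange' z).2 h))
  have hF : nc R'.φ = nc (R.σ * al H') := by
    have hφ : ∀ x, R'.φ x = s x.symm := fun x => rfl
    refine firstReturn_nc _ _ ι hι ?_ ?_ ?_
    · intro z hz
      rw [Equiv.Perm.mul_apply, hal' z hz]
      exact hX z hz
    · intro x hx
      rw [Equiv.Perm.mul_apply, hal] at hx ⊢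
      rw [hφ, hs1 _ hx]
    · intro x hx
      rw [Equiv.Perm.mul_apply] at hx
      rw [Equiv.Perm.mul_apply, Equiv.Perm.mul_apply]
      rw [hal'  _ hx]
      rw [hal] at hx ⊢
      rw [hφ, hs2 _ hx]
  have hmain := euler_del R hR a b hab
  rw [← hH', ← hF] at hmain
  have hV : Nat.card V = Fintype.card W := by
    rw [← Nat.card_eq_fintype_card]; exact (Nat.card_congr e.toEquiv).symm
  have hEd : Nat.card H'.edgeSet = Nat.card G.edgeSet := (Nat.card_congr e.mapEdgeSet).symm
  have hC : cc H' = Nat.card G.ConnectedComponent :=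
    (Nat.card_congr e.connectedComponentEquiv).symm
  rw [hV, hEd, hC] at hmain
  exact hmain

end Cfg3

namespace Cfg3

lemma vdeg_le_of_inj {V W : Type*} [Finite V] {G : SimpleGraph W} {H : SimpleGraph V}
    (f : G →g H) (hf : Function.Injective f) (w : W) : vdeg G w ≤ vdeg H (f w) := by
  refine Nat.card_le_card_of_injective
    (fun x : G.neighborSet w => (⟨f x, f.map_adj x.2⟩ : H.neighborSet (f w))) ?_
  intro a b hab
  exact Subtype.ext (hf (congrArg Subtype.val hab))

lemma edges_map_ne {V W : Type*} {G : SimpleGraph W} {H : SimpleGraph V}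
    (f : G →g H) (hf : Function.Injective f) {w : W} (c₁ c₂ : G.Walk w w)
    (h : {e | e ∈ c₁.edges} ≠ {e | e ∈ c₂.edges}) :
    {e | e ∈ (c₁.map f).edges} ≠ {e | e ∈ (c₂.map f).edges} := by
  intro hh
  apply h
  have key : ∀ c : G.Walk w w, {e | e ∈ (c.map f).edges} = Sym2.map f '' {e | e ∈ c.edges} := by
    intro c
    ext e
    simp [SimpleGraph.Walk.edges_map]
  rw [key, key] at hh
  exact (Sym2.map.injective hf).image_injective hh

lemma good6_of_inj {V W : Type*} [Finite V] {G : SimpleGraph W} {H : SimpleGraph V}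
    (f : G →g H) (hf : Function.Injective f) (hmax : ∀ v, vdeg H v ≤ 6)
    (h : Good6Vertices H) : Good6Vertices G := by
  intro w hw
  have h6 : vdeg H (f w) = 6 := le_antisymm (hmax _) (hw ▸ vdeg_le_of_inj f hf w)
  rcases h (f w) h6 with h | h
  · left
    rintro ⟨c₁, c₂, h1, h2, h3, h4, h5, e, h6, h7⟩
    refine h ⟨c₁.map f, c₂.map f, h1.map hf, h2.map hf, by simpa, by simpa,
      edges_map_ne f hf _ _ h5, Sym2.map f e, ?_, ?_⟩
    · rw [SimpleGraph.Walk.edges_map]; exact List.mem_map_of_mem h6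
    · rw [SimpleGraph.Walk.edges_map]; exact List.mem_map_of_mem h7
  · right
    intro p q l hpq
    rintro ⟨c₁, c₂, c₃, h1, h2, h3, h4, h5, h6, h7, h8, h9⟩
    exact h p q l hpq ⟨c₁.map f, c₂.map f, c₃.map f, h1.map hf, h2.map hf, h3.map hf,
      by simpa, by simpa, by simpa,
      edges_map_ne f hf _ _ h7, edges_map_ne f hf _ _ h8, edges_map_ne f hf _ _ h9⟩

lemma copy_of_inj {α V W : Type*} {K : SimpleGraph α} {G : SimpleGraph W} {H : SimpleGraph V}
    (f : G →g H) (hf : Function.Injective f) (h : ContainsCopy K G) : ContainsCopy K H := by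
  obtain ⟨g, hg, hg'⟩ := h
  exact ⟨f ∘ g, hf.comp hg, fun u v huv => f.map_adj (hg' huv)⟩

/-- By minimality, deleting a suitable edge gives a totally 7-colorable graph. -/
lemma del_colorable {V : Type*} [Fintype V] {H : SimpleGraph V} (hmin : MinimalCounterexample H)
    (a b a' b' v : V) (hab : H.Adj a b) (haa : H.Adj a a') (ha' : a' ≠ b)
    (hbb : H.Adj b b') (hb' : b' ≠ a) (hv : vdeg H v = 6) (hva : v ≠ a) (hvb : v ≠ b) :
    TotallyColorable (H.deleteEdges {s(a, b)}) 7 := by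
  obtain ⟨⟨hpl, ⟨hmax, -⟩, hdi, hho, hgood⟩, -, hm⟩ := hmin
  let e : Fin (Fintype.card V) ≃ V := (Fintype.equivFin V).symm
  let G := (H.deleteEdges {s(a, b)}).comap e
  let i : G ≃g H.deleteEdges {s(a, b)} := SimpleGraph.Iso.comap e _
  have hle : H.deleteEdges {s(a, b)} ≤ H := SimpleGraph.deleteEdges_le _
  let f : G →g H := (SimpleGraph.Hom.ofLE hle).comp i.toHom
  have hf : Function.Injective f := e.injective
  have hfe : ∀ x, f x = e x := fun _ => rfl
  have hG : GoodGraph G := by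
    refine ⟨planar_del hpl a b a' b' hab haa ha' hbb hb' G i, ⟨?_, e.symm v, ?_⟩,
      fun h => hdi (copy_of_inj f hf h), fun h => hho (copy_of_inj f hf h),
      good6_of_inj f hf hmax hgood⟩
    · intro w
      exact (vdeg_le_of_inj f hf w).trans (hmax _)
    · rw [← hv]
      refine Nat.card_congr (e.subtypeEquiv ?_)
      intro w
      simp only [SimpleGraph.mem_neighborSet, G, SimpleGraph.comap_adj,
        SimpleGraph.deleteEdges_adj, Equiv.apply_symm_apply]
      constructor
      · exact fun h => h.1
      · intro h
        refine ⟨h, ?_⟩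
        intro hh
        rcases Sym2.eq_iff.1 hh with ⟨h1, h2⟩ | ⟨h1, h2⟩
        · exact hva h1
        · exact hvb h1
  have hcol : TotallyColorable G 7 := by
    by_contra hcon
    have h1 := hm _ G hG hcon
    have h2 := card_edges_del H a b hab
    have h3 : Nat.card G.edgeSet = _ := Nat.card_congr i.mapEdgeSet
    omega
  obtain ⟨cv, ce, h1, h2, h3⟩ := hcol
  have hA : ∀ {x y}, (H.deleteEdges {s(a, b)}).Adj x y → G.Adj (e.symm x) (e.symm y) := by
    intro x y hxy
    simpa [G] using hxy
  refine ⟨cv ∘ e.symm, ce ∘ Sym2.map e.symm, fun u v huv => h1 (hA huv), ?_,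
    fun u v huv => h3 (hA huv)⟩
  intro e₁ he₁ e₂ he₂ hne ⟨x, hx1, hx2⟩
  have hE : ∀ z ∈ (H.deleteEdges {s(a, b)}).edgeSet, Sym2.map e.symm z ∈ G.edgeSet := by
    intro z hz
    induction z using Sym2.ind with
    | _ p q => exact hA hz
  refine h2 _ (hE _ he₁) _ (hE _ he₂) ?_ ⟨e.symm x, ?_, ?_⟩
  · intro h; exact hne (Sym2.map.injective e.symm.injective h)
  · exact Sym2.mem_map.2 ⟨x, hx1, rfl⟩
  · exact Sym2.mem_map.2 ⟨x, hx2, rfl⟩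

/-- Total coloring, apart from the colors of the vertices in `T`. -/
structure PC {V : Type*} (H : SimpleGraph V) (T : Set V) (cv : V → Fin 7)
    (ce : Sym2 V → Fin 7) : Prop where
  vv : ∀ a b, H.Adj a b → a ∉ T → b ∉ T → cv a ≠ cv b
  ee : ∀ w a b, H.Adj w a → H.Adj w b → a ≠ b → ce s(w, a) ≠ ce s(w, b)
  ev : ∀ w a, H.Adj w a → w ∉ T → ce s(w, a) ≠ cv w

lemma PC.elim {V : Type*} [Finite V] {H : SimpleGraph V} {T : Set V} {cv : V → Fin 7}
    {ce : Sym2 V → Fin 7} (h : PC H T cv ce) (x : V) (hx : vdeg H x ≤ 3) :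
    ∃ cv', PC H (T \ {x}) cv' ce := by
  classical
  have := Fintype.ofFinite V
  let N : Finset V := H.neighborFinset x
  have hN : N.card ≤ 3 := by
    have : vdeg H x = N.card := by
      rw [vdeg, Nat.card_eq_fintype_card, SimpleGraph.card_neighborSet_eq_degree]; rfl
    omega
  have hex : ∃ c : Fin 7, c ∉ N.image cv ∪ N.image (fun w => ce s(x, w)) := by
    by_contra hcon
    push Not at hcon
    have h1 : (Finset.univ : Finset (Fin 7)) ⊆ N.image cv ∪ N.image (fun w => ce s(x, w)) :=
      fun c _ => hcon c
    have h2 := Finset.card_le_card h1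
    have h3 := Finset.card_union_le (N.image cv) (N.image (fun w => ce s(x, w)))
    have h4 := Finset.card_image_le (s := N) (f := cv)
    have h5 := Finset.card_image_le (s := N) (f := (fun w => ce s(x, w)))
    simp at h2
    omega
  obtain ⟨c, hc⟩ := hex
  have hc1 : ∀ w, H.Adj x w → cv w ≠ c := by
    intro w hw e
    apply hc
    rw [Finset.mem_union, Finset.mem_image]
    left; exact ⟨w, by simpa [N] using hw, e⟩
  have hc2 : ∀ w, H.Adj x w → ce s(x, w) ≠ c := by
    intro w hw e
    apply hc
    rw [Finset.mem_union, Finset.mem_image, Finset.mem_image]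
    right; exact ⟨w, by simpa [N] using hw, e⟩
  refine ⟨Function.update cv x c, ?_, h.ee, ?_⟩
  · intro a b hab ha hb
    by_cases h1 : a = x
    · subst h1
      have h2 : b ≠ a := hab.ne'
      rw [Function.update_self, Function.update_of_ne h2]
      exact (hc1 b hab).symm
    · by_cases h2 : b = x
      · subst h2
        rw [Function.update_self, Function.update_of_ne h1]
        exact (hc1 a hab.symm)
      · rw [Function.update_of_ne h1, Function.update_of_ne h2]
        exact h.vv a b hab (fun h => ha ⟨h, h1⟩) (fun h => hb ⟨h, h2⟩)
  · intro w a hwa hw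
    by_cases h1 : w = x
    · subst h1
      rw [Function.update_self]; exact hc2 a hwa
    · rw [Function.update_of_ne h1]
      exact h.ev w a hwa (fun h => hw ⟨h, h1⟩)

lemma PC.finish {V : Type*} {H : SimpleGraph V} {cv : V → Fin 7}
    {ce : Sym2 V → Fin 7} (h : PC H ∅ cv ce) : TotallyColorable H 7 := by
  refine ⟨cv, ce, fun u v huv => h.vv u v huv (by simp) (by simp), ?_,
    fun u v huv => h.ev u v huv (by simp)⟩
  rintro e₁ he₁ e₂ he₂ hne ⟨x, hx1, hx2⟩
  obtain ⟨a, rfl⟩ := hx1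
  obtain ⟨b, rfl⟩ := hx2
  exact h.ee x a b he₁ he₂ (fun e => hne (by rw [e]))

/-- Exchange the colors of two edges with a common endpoint. -/
lemma PC.swap {V : Type*} {H : SimpleGraph V} {T : Set V} {cv : V → Fin 7}
    {ce : Sym2 V → Fin 7} (h : PC H T cv ce) (w p q : V) (hp : H.Adj w p) (hq : H.Adj w q)
    (hpq : p ≠ q)
    (h1 : ∀ r, H.Adj p r → r ≠ w → ce s(p, r) ≠ ce s(w, q))
    (h2 : ∀ r, H.Adj q r → r ≠ w → ce s(q, r) ≠ ce s(w, p))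
    (h3 : p ∉ T → ce s(w, q) ≠ cv p) (h4 : q ∉ T → ce s(w, p) ≠ cv q) :
    ∃ ce', PC H T cv ce' ∧ ce' s(w, p) = ce s(w, q) ∧ ce' s(w, q) = ce s(w, p) ∧
      ∀ e, e ≠ s(w, p) → e ≠ s(w, q) → ce' e = ce e := by
  classical
  have hwp := hp.ne
  have hwq := hq.ne
  let τ := Equiv.swap s(w, p) s(w, q)
  have e1 : ce (τ s(w, p)) = ce s(w, q) := by simp [τ]
  have e2 : ce (τ s(w, q)) = ce s(w, p) := by simp [τ]
  have e3 : ∀ e, e ≠ s(w, p) → e ≠ s(w, q) → ce (τ e) = ce e := by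
    intro e he he'
    simp only [τ]
    rw [Equiv.swap_apply_of_ne_of_ne he he']
  have hw : ∀ a, H.Adj w a → τ s(w, a) = s(w, Equiv.swap p q a) ∧ H.Adj w (Equiv.swap p q a) := by
    intro a ha
    by_cases hap : a = p
    · subst hap; simp [τ, hq]
    by_cases haq : a = q
    · subst haq; simp [τ, hp]
    rw [Equiv.swap_apply_of_ne_of_ne hap haq]
    refine ⟨?_, ha⟩
    simp only [τ]
    rw [Equiv.swap_apply_of_ne_of_ne] <;> simp [hap, haq, hwp, hwq]
  have e4 : ∀ r, r ≠ w → ce (τ s(p, r)) = ce s(p, r) := by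
    intro r hr
    apply e3 <;> simp [hwp.symm, hr, hpq]
  have e5 : ∀ r, r ≠ w → ce (τ s(q, r)) = ce s(q, r) := by
    intro r hr
    apply e3 <;> simp [hwq.symm, hr]
  have e6 : ∀ c r, c ≠ w → c ≠ p → c ≠ q → ce (τ s(c, r)) = ce s(c, r) := by
    intro c r hc hc1 hc2
    apply e3 <;> simp [hc, hc1, hc2]
  have e1' : ce (τ s(p, w)) = ce s(w, q) := by rw [Sym2.eq_swap, e1]
  have e2' : ce (τ s(q, w)) = ce s(w, p) := by rw [Sym2.eq_swap, e2]
  refine ⟨ce ∘ τ, ⟨h.vv, ?_, ?_⟩, e1, e2, e3⟩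
  · intro c a b hca hcb hab
    simp only [Function.comp_apply]
    by_cases hcw : c = w
    · subst hcw
      rw [(hw a hca).1, (hw b hcb).1]
      exact h.ee _ _ _ (hw a hca).2 (hw b hcb).2 (fun e => hab ((Equiv.swap p q).injective e))
    by_cases hcp : c = p
    · subst hcp
      by_cases haw : a = w
      · subst haw
        rw [e1', e4 b hab.symm]
        exact (h1 b hcb hab.symm).symm
      · by_cases hbw : b = w
        · subst hbw
          rw [e1', e4 a haw]
          exact h1 a hca haw
        · rw [e4 a haw, e4 b hbw]
          exact h.ee _ _ _ hca hcb hab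
    by_cases hcq : c = q
    · subst hcq
      by_cases haw : a = w
      · subst haw
        rw [e2', e5 b hab.symm]
        exact (h2 b hcb hab.symm).symm
      · by_cases hbw : b = w
        · subst hbw
          rw [e2', e5 a haw]
          exact h2 a hca haw
        · rw [e5 a haw, e5 b hbw]
          exact h.ee _ _ _ hca hcb hab
    rw [e6 c a hcw hcp hcq, e6 c b hcw hcp hcq]
    exact h.ee _ _ _ hca hcb hab
  · intro c a hca hcT
    simp only [Function.comp_apply]
    by_cases hcw : c = w
    · subst hcw
      rw [(hw a hca).1]
      exact h.ev _ _ (hw a hca).2 hcT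
    by_cases hcp : c = p
    · subst hcp
      by_cases haw : a = w
      · subst haw; rw [e1']; exact h3 hcT
      · rw [e4 a haw]; exact h.ev _ _ hca hcT
    by_cases hcq : c = q
    · subst hcq
      by_cases haw : a = w
      · subst haw; rw [e2']; exact h4 hcT
      · rw [e5 a haw]; exact h.ev _ _ hca hcT
    rw [e6 c a hcw hcp hcq]
    exact h.ev _ _ hca hcT

/-- Color the deleted edge. -/
lemma PC.ext {V : Type*} {H : SimpleGraph V} {T : Set V} {cv : V → Fin 7}
    {ce : Sym2 V → Fin 7} (x u v : V) (h : PC (H.deleteEdges {s(x, u)}) T cv ce)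
    (hxT : x ∈ T) (huT : u ∉ T)
    (hx : ∀ w, H.Adj x w → w = v ∨ w = u) (k : Fin 7)
    (hk1 : ∀ w, (H.deleteEdges {s(x, u)}).Adj u w → ce s(u, w) ≠ k) (hk2 : cv u ≠ k)
    (hk3 : ce s(v, x) ≠ k) :
    ∃ ce', PC H T cv ce' := by
  classical
  have hxu : x ≠ u := fun e => huT (e ▸ hxT)
  have hA : ∀ {a b}, H.Adj a b → s(a, b) ≠ s(x, u) → (H.deleteEdges {s(x, u)}).Adj a b := by
    intro a b hab hne
    rw [SimpleGraph.deleteEdges_adj]; exact ⟨hab, hne⟩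
  have key : ∀ w a b, H.Adj w a → H.Adj w b → a ≠ b → s(w, a) = s(x, u) → ce s(w, b) ≠ k := by
    intro w a b hwa hwb hab he
    rcases Sym2.eq_iff.1 he with ⟨rfl, rfl⟩ | ⟨rfl, rfl⟩
    · rcases hx b hwb with rfl | rfl
      · rwa [Sym2.eq_swap]
      · exact absurd rfl hab
    · apply hk1
      apply hA hwb
      simp [hab.symm, hxu.symm]
  refine ⟨Function.update ce s(x, u) k, ?_, ?_, ?_⟩
  · intro a b hab ha hb
    refine h.vv a b (hA hab ?_) ha hb
    intro e
    rcases Sym2.eq_iff.1 e with ⟨rfl, rfl⟩ | ⟨rfl, rfl⟩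
    · exact ha hxT
    · exact hb hxT
  · intro w a b hwa hwb hab
    by_cases h1 : s(w, a) = s(x, u)
    · have h2 : s(w, b) ≠ s(x, u) := by
        rw [← h1]; intro e; exact hab (Sym2.congr_right.1 e).symm
      rw [h1, Function.update_self, Function.update_of_ne h2]
      exact (key w a b hwa hwb hab h1).symm
    · by_cases h2 : s(w, b) = s(x, u)
      · rw [h2, Function.update_self, Function.update_of_ne h1]
        exact key w b a hwb hwa hab.symm h2
      · rw [Function.update_of_ne h1, Function.update_of_ne h2]
        exact h.ee w a b (hA hwa h1) (hA hwb h2) hab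
  · intro w a hwa hw
    by_cases h1 : s(w, a) = s(x, u)
    · rw [h1, Function.update_self]
      rcases Sym2.eq_iff.1 h1 with ⟨rfl, rfl⟩ | ⟨rfl, rfl⟩
      · exact absurd hxT hw
      · exact hk2.symm
    · rw [Function.update_of_ne h1]
      exact h.ev w a (hA hwa h1) hw

end Cfg3

namespace Cfg3

lemma nbr_two {V : Type*} [Finite V] {H : SimpleGraph V} {x a b : V} (hx : vdeg H x = 2)
    (ha : H.Adj x a) (hb : H.Adj x b) (hab : a ≠ b) (w : V) (hw : H.Adj x w) : w = a ∨ w = b := by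
  by_contra hcon
  push Not at hcon
  have h1 : ({w, a, b} : Set V) ⊆ H.neighborSet x := by
    rintro z (rfl | rfl | rfl) <;> assumption
  have h2 := Set.ncard_le_ncard h1 (Set.toFinite _)
  have h3 : ({w, a, b} : Set V).ncard = 3 := by
    rw [Set.ncard_eq_three]
    exact ⟨w, a, b, hcon.1, hcon.2, hab, rfl⟩
  rw [vdeg, Nat.card_coe_set_eq] at hx
  omega

lemma nbr_three {V : Type*} [Finite V] {H : SimpleGraph V} {x a b c : V} (hx : vdeg H x = 3)
    (ha : H.Adj x a) (hb : H.Adj x b) (hc : H.Adj x c) (hab : a ≠ b) (hac : a ≠ c) (hbc : b ≠ c)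
    (w : V) (hw : H.Adj x w) : w = a ∨ w = b ∨ w = c := by
  by_contra hcon
  push Not at hcon
  have h1 : ({w, a, b, c} : Set V) ⊆ H.neighborSet x := by
    rintro z (rfl | rfl | rfl | rfl) <;> assumption
  have h2 := Set.ncard_le_ncard h1 (Set.toFinite _)
  have h3 : ({a, b, c} : Set V).ncard = 3 := by
    rw [Set.ncard_eq_three]
    exact ⟨a, b, c, hab, hac, hbc, rfl⟩
  rw [Set.ncard_insert_of_notMem (by simp [hcon]) (Set.toFinite _)] at h2
  rw [vdeg, Nat.card_coe_set_eq] at hx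
  omega

/-- A vertex with at most five incident edges misses a color. -/
lemma exists_missing {V : Type*} [Finite V] {K : SimpleGraph V} (u : V) (hu : vdeg K u ≤ 5)
    (cv : V → Fin 7) (ce : Sym2 V → Fin 7) :
    ∃ k, (∀ w, K.Adj u w → ce s(u, w) ≠ k) ∧ cv u ≠ k := by
  classical
  have := Fintype.ofFinite V
  let N : Finset V := K.neighborFinset u
  have hN : N.card ≤ 5 := by
    have : vdeg K u = N.card := by
      rw [vdeg, Nat.card_eq_fintype_card, SimpleGraph.card_neighborSet_eq_degree]; rfl
    omega
  have hex : ∃ c : Fin 7, c ∉ insert (cv u) (N.image (fun w => ce s(u, w))) := by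
    by_contra hcon
    push Not at hcon
    have h1 : (Finset.univ : Finset (Fin 7)) ⊆ insert (cv u) (N.image (fun w => ce s(u, w))) :=
      fun c _ => hcon c
    have h2 := Finset.card_le_card h1
    have h3 := Finset.card_insert_le (cv u) (N.image (fun w => ce s(u, w)))
    have h5 := Finset.card_image_le (s := N) (f := (fun w => ce s(u, w)))
    simp only [Finset.card_univ, Fintype.card_fin] at h2
    omega
  obtain ⟨c, hc⟩ := hex
  rw [Finset.mem_insert, Finset.mem_image] at hc
  push Not at hc
  exact ⟨c, fun w hw => hc.2 w (by simpa [N] using hw), hc.1.symm⟩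

lemma vdeg_del_lt {V : Type*} [Finite V] {H : SimpleGraph V} (x u : V) (h : H.Adj x u) :
    vdeg (H.deleteEdges {s(x, u)}) u + 1 ≤ vdeg H u := by
  simp only [vdeg, Nat.card_coe_set_eq]
  apply Set.ncard_lt_ncard _ (Set.toFinite _)
  rw [Set.ssubset_iff_of_subset]
  · exact ⟨x, h.symm, by simp [Sym2.eq_swap]⟩
  · intro w hw
    exact (SimpleGraph.deleteEdges_le _) hw

lemma core {V : Type*} [Finite V] {H : SimpleGraph V} {T : Set V} {cv : V → Fin 7}
    {ce : Sym2 V → Fin 7} (v x₁ x₂ y u₁ u₂ : V)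
    (h12 : x₁ ≠ x₂) (hy1 : y ≠ x₁) (hy2 : y ≠ x₂)
    (hv1 : H.Adj v x₁) (hv2 : H.Adj v x₂) (hvy : H.Adj v y)
    (hxu : H.Adj x₁ u₁) (hu1v : u₁ ≠ v) (hxu2 : H.Adj x₂ u₂) (hu2v : u₂ ≠ v)
    (huu : H.Adj u₁ u₂) (hu2y : H.Adj u₂ y)
    (hx1 : ∀ w, H.Adj x₁ w → w = v ∨ w = u₁) (hx2 : ∀ w, H.Adj x₂ w → w = v ∨ w = u₂)
    (hu1x2 : u₁ ≠ x₂) (hu1y : u₁ ≠ y) (hu2x1 : u₂ ≠ x₁)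
    (hy : vdeg H y = 3)
    (hT : T = {x₁, x₂, y}) (hu1 : vdeg H u₁ ≤ 6)
    (h : PC (H.deleteEdges {s(x₁, u₁)}) T cv ce) : ∃ ce', PC H T cv ce' := by
  classical
  set K := H.deleteEdges {s(x₁, u₁)} with hK
  have hKadj : ∀ a b, K.Adj a b ↔ H.Adj a b ∧ s(a, b) ≠ s(x₁, u₁) := by
    intro a b; rw [hK, SimpleGraph.deleteEdges_adj]; rfl
  have hx1T : x₁ ∈ T := by simp [hT]
  have hx2T : x₂ ∈ T := by simp [hT]
  have hyT : y ∈ T := by simp [hT]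
  have hu1T : u₁ ∉ T := by simp [hT, hxu.ne.symm, hu1x2, hu1y]
  have n1 := hv1.ne
  have n2 := hv2.ne
  have n3 := hvy.ne
  have n4 := hxu.ne
  have n5 := hxu2.ne
  have n6 := huu.ne
  have n7 := hu2y.ne
  have kv1 : K.Adj v x₁ := (hKadj _ _).2 ⟨hv1, by simp [n1, hu1v.symm]⟩
  have kv2 : K.Adj v x₂ := (hKadj _ _).2 ⟨hv2, by simp [n1, hu1v.symm]⟩
  have kvy : K.Adj v y := (hKadj _ _).2 ⟨hvy, by simp [n1, hu1v.symm]⟩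
  have kxu2 : K.Adj x₂ u₂ := (hKadj _ _).2 ⟨hxu2, by simp [h12.symm, hu1x2.symm]⟩
  have kuu : K.Adj u₁ u₂ := (hKadj _ _).2 ⟨huu, by simp [n4.symm, hu2x1]⟩
  have ku2y : K.Adj u₂ y := (hKadj _ _).2 ⟨hu2y, by simp [hu2x1, n6.symm]⟩
  have kx1 : ∀ w, K.Adj x₁ w → w = v := by
    intro w hw
    rcases hx1 w ((hKadj _ _).1 hw).1 with h | h
    · exact h
    · subst h; exact absurd rfl ((hKadj _ _).1 hw).2
  have kx2 : ∀ w, K.Adj x₂ w → w = v ∨ w = u₂ := fun w hw => hx2 w ((hKadj _ _).1 hw).1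
  obtain ⟨k, hk1, hk2⟩ := exists_missing (K := K) u₁
    (by have := vdeg_del_lt x₁ u₁ hxu; rw [← hK] at this; omega) cv ce
  by_cases hk3 : ce s(v, x₁) = k
  swap
  · exact PC.ext x₁ u₁ v h hx1T hu1T hx1 k hk1 hk2 hk3
  -- the color `k` is on `v x₁`; move it to another edge at `v` if possible
  have move : ∀ p, p ∈ T → p ≠ x₁ → K.Adj v p → p ≠ u₁ → (∀ r, K.Adj p r → r ≠ v → ce s(p, r) ≠ k) →
      ∃ ce', PC H T cv ce' := by
    intro p hpT hp1 hvp hpu hp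
    obtain ⟨ce', h', e1, e2, e3⟩ := h.swap v x₁ p kv1 hvp hp1.symm
      (fun r hr hrv => absurd (kx1 r hr) hrv) (by rw [hk3]; exact hp)
      (fun h => absurd hx1T h) (fun h => absurd hpT h)
    refine PC.ext x₁ u₁ v h' hx1T hu1T hx1 k ?_ hk2 ?_
    · intro w hw
      rw [e3]
      · exact hk1 w hw
      · simp [hu1v, n4.symm]
      · simp [hu1v, hpu.symm]
    · rw [e1, ← hk3]; exact h.ee _ _ _ hvp kv1 hp1
  by_cases hc2 : ce s(x₂, u₂) = k
  swap
  · refine move x₂ hx2T h12.symm kv2 hu1x2.symm ?_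
    intro r hr hrv
    rcases kx2 r hr with h | rfl
    · exact absurd h hrv
    · exact hc2
  -- the color `t` of `u₁ u₂` can be exchanged with `k` unless it is on `v x₂`
  have move2 : ∀ ce₀, PC K T cv ce₀ → (∀ w, K.Adj u₁ w → ce₀ s(u₁, w) ≠ k) →
      ce₀ s(v, x₁) = k → ce₀ s(x₂, u₂) = k → ce₀ s(u₁, u₂) ≠ ce₀ s(v, x₂) →
      ∃ ce', PC H T cv ce' := by
    intro ce₀ h hk1 hk3 hc2 hne
    have hc2' : ce₀ s(u₂, x₂) = k := by rw [Sym2.eq_swap]; exact hc2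
    obtain ⟨ce', h', e1, e2, e3⟩ := h.swap u₂ u₁ x₂ kuu.symm kxu2.symm hu1x2
      (fun r hr hrv => by rw [hc2']; exact hk1 r hr)
      (fun r hr hrv => by
        have := (kx2 r hr).resolve_right hrv
        subst this
        rw [Sym2.eq_swap, Sym2.eq_swap (a := u₂)]; exact hne.symm)
      (fun _ => by rw [hc2']; exact hk2.symm) (fun h => absurd hx2T h)
    have ht : k ≠ ce₀ s(u₁, u₂) := (hk1 u₂ kuu).symm
    refine PC.ext x₁ u₁ v h' hx1T hu1T hx1 (ce₀ s(u₁, u₂)) ?_ ?_ ?_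
    · intro w hw
      by_cases hwu : w = u₂
      · subst hwu
        rw [Sym2.eq_swap, e1, hc2', Sym2.eq_swap]; exact ht
      · rw [e3]
        · exact h.ee _ _ _ hw kuu hwu
        · simp [n6, hwu]
        · simp [n6, hu1x2]
    · exact (h.ev _ _ kuu hu1T).symm
    · rw [e3, hk3]
      · exact ht
      · simp [hu2v.symm, hu1v.symm]
      · simp [hu2v.symm, n2]
  by_cases hne : ce s(u₁, u₂) = ce s(v, x₂)
  swap
  · exact move2 ce h hk1 hk3 hc2 hne
  by_contra hcon
  apply hcon
  -- first exchange the colors of `v y` and `v x₂`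
  obtain ⟨ce', h', e1, e2, e3⟩ : ∃ ce', PC K T cv ce' ∧ ce' s(v, y) = ce s(v, x₂) ∧
      ce' s(v, x₂) = ce s(v, y) ∧ ∀ e, e ≠ s(v, y) → e ≠ s(v, x₂) → ce' e = ce e := by
    by_cases hyk : ∀ r, K.Adj y r → r ≠ v → ce s(y, r) ≠ k
    · exact absurd (move y hyT hy1 kvy hu1y.symm hyk) hcon
    push Not at hyk
    obtain ⟨z, hz, hzv, hzk⟩ := hyk
    have hzu : z ≠ u₂ := by
      rintro rfl
      apply h.ee z y x₂ ku2y kxu2.symm hy2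
      rw [Sym2.eq_swap, hzk, Sym2.eq_swap, hc2]
    refine h.swap v y x₂ kvy kv2 hy2 ?_ ?_ (fun h => absurd hyT h) (fun h => absurd hx2T h)
    · intro r hr hrv
      rw [← hne]
      rcases nbr_three hy hvy.symm hu2y.symm ((hKadj _ _).1 hz).1 hu2v.symm hzv.symm hzu.symm r
        ((hKadj _ _).1 hr).1 with h1 | rfl | rfl
      · exact absurd h1 hrv
      · rw [Sym2.eq_swap, Sym2.eq_swap (a := u₁)]
        exact h.ee _ _ _ ku2y kuu.symm hu1y.symm
      · rw [hzk]; exact (hk1 _ kuu).symm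
    · intro r hr hrv
      have := (kx2 r hr).resolve_left hrv
      subst this
      rw [hc2, ← hk3]
      exact h.ee _ _ _ kv1 kvy hy1.symm
  refine move2 ce' h' ?_ ?_ ?_ ?_
  · intro w hw
    rw [e3]
    · exact hk1 w hw
    · simp [hu1v, hu1y]
    · simp [hu1v, hu1x2]
  · rw [e3, hk3]
    · simp [hy1.symm, n3]
    · simp [h12, n2]
  · rw [e3, hc2]
    · simp [n2.symm, hu2v]
    · simp [n2.symm, hu2v]
  · rw [e3, e2, hne]
    · exact h.ee _ _ _ kv2 kvy hy2.symm
    · simp [hu1v, hu2v]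
    · simp [hu1v, hu2v]

end Cfg3

/-- **Forbidden configuration (3).** A minimal counterexample has no 6-vertex `v` with two
distinct neighbors `x₁, x₂` of degree 2 and a neighbor `y` of degree 3 (all distinct),
such that the neighbor `u₁` of `x₁` other than `v` and the neighbor `u₂` of `x₂` other
than `v` are adjacent, and `u₂` is also adjacent to `y`. -/
theorem minimal_counterexample_no_config_three
    {V : Type*} [Fintype V] (H : SimpleGraph V)
    (hmin : MinimalCounterexample H) :
    ¬ ∃ (v x₁ x₂ y u₁ u₂ : V),
      vdeg H v = 6 ∧
      x₁ ≠ x₂ ∧ y ≠ x₁ ∧ y ≠ x₂ ∧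
      H.Adj v x₁ ∧ H.Adj v x₂ ∧ H.Adj v y ∧
      vdeg H x₁ = 2 ∧ vdeg H x₂ = 2 ∧ vdeg H y = 3 ∧
      H.Adj x₁ u₁ ∧ u₁ ≠ v ∧
      H.Adj x₂ u₂ ∧ u₂ ≠ v ∧
      H.Adj u₁ u₂ ∧ H.Adj u₂ y := by
  rintro ⟨v, x₁, x₂, y, u₁, u₂, hv, h12, hy1, hy2, hv1, hv2, hvy, hd1, hd2, hdy, hxu, hu1v,
    hxu2, hu2v, huu, hu2y⟩
  have hx1 := Cfg3.nbr_two hd1 hv1.symm hxu hu1v.symm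
  have hx2 := Cfg3.nbr_two hd2 hv2.symm hxu2 hu2v.symm
  have hu2x1 : u₂ ≠ x₁ := by
    rintro rfl
    rcases hx1 y hu2y with h | h
    · exact hvy.ne h.symm
    · subst h
      rcases hx1 x₂ hxu2.symm with h | h
      · exact hv2.ne h.symm
      · exact hy2 h.symm
  have hu1x2 : u₁ ≠ x₂ := by
    rintro rfl
    rcases hx2 x₁ hxu.symm with h | h
    · exact hv1.ne h.symm
    · exact hu2x1 h.symm
  have hu1y : u₁ ≠ y := by
    rintro rfl
    apply hmin.1.2.2.2.1
    refine ⟨![x₁, v, x₂, u₂, u₁], ?_, ?_⟩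
    · intro i j hij
      have n1 := hv1.ne
      have n2 := hv2.ne
      have n3 := hvy.ne
      have n4 := hxu2.ne
      have n5 := hu2y.ne
      fin_cases i <;> fin_cases j <;> simp_all
    · have := hv1.symm
      have := hv2.symm
      have := hvy.symm
      have := hxu.symm
      have := hxu2.symm
      intro i j hij
      fin_cases i <;> fin_cases j <;> simp_all [houseGraph]
  have hcol := Cfg3.del_colorable hmin x₁ u₁ v u₂ v hxu hv1.symm hu1v.symm huu hu2x1 hv hv1.ne
    hu1v.symm
  obtain ⟨cv, ce, h1, h2, h3⟩ := hcol
  have hPC : Cfg3.PC (H.deleteEdges {s(x₁, u₁)}) {x₁, x₂, y} cv ce := by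
    refine ⟨fun a b hab _ _ => h1 hab, ?_, fun a b hab _ => h3 hab⟩
    intro w a b ha hb hab
    refine h2 _ ha _ hb ?_ ⟨w, by simp, by simp⟩
    intro e
    exact hab (Sym2.congr_right.1 e)
  obtain ⟨ce', h⟩ := Cfg3.core v x₁ x₂ y u₁ u₂ h12 hy1 hy2 hv1 hv2 hvy hxu hu1v hxu2 hu2v huu hu2y
    hx1 hx2 hu1x2 hu1y hu2x1 hdy rfl (hmin.1.2.1.1 u₁) hPC
  obtain ⟨c1, h⟩ := h.elim x₁ (by omega)
  obtain ⟨c2, h⟩ := h.elim x₂ (by omega)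
  obtain ⟨c3, h⟩ := h.elim y (by omega)
  apply hmin.2.1
  have hemp : ((({x₁, x₂, y} : Set V) \ {x₁}) \ {x₂}) \ {y} = ∅ := by
    ext z
    simp only [Set.mem_diff, Set.mem_insert_iff, Set.mem_singleton_iff, Set.mem_empty_iff_false]
    tauto
  rw [hemp] at h
  exact h.finish
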